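/- arXiv:2306.05195 — 2 statements merged into one kernel-verified Lean document; each statement's English description precedes it below -/
import Mathlib

section
/- Blindness of the full two-qubit initial state: for every 4×4 complex matrix ρ (indexed by pairs in Fin 2 × Fin 2), (1/64) · Σ_{k=0}^{7} Σ_{l=0}^{7} (Rz(kπ/4) ⊗ Rz(lπ/4)) · ρ · (Rz(kπ/4) ⊗ Rz(lπ/4))† equals the diagonal matrix whose diagonal agrees with that of ρ; i.e., independently averaging z-rotations from 𝒜 on the two qubits removes every off-diagonal entry of ρ. -/
open Real Matrix Kronecker

/-- The single-qubit z-rotation matrix `Rz θ = !![1, 0; 0, e^{iθ}]`. -/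
noncomputable def Rz (θ : ℝ) : Matrix (Fin 2) (Fin 2) ℂ :=
  !![1, 0; 0, Complex.exp (θ * Complex.I)]

noncomputable def rzDiag (θ : ℝ) : Fin 2 → ℂ := ![1, Complex.exp (θ * Complex.I)]

lemma Rz_eq_diagonal (θ : ℝ) : Rz θ = Matrix.diagonal (rzDiag θ) := by
  ext i j
  fin_cases i <;> fin_cases j <;> simp [Rz, rzDiag]

/-- The eighth roots of unity sum to zero. -/
lemma sum_exp_eighth :
    ∑ k : Fin 8, Complex.exp (((((k : ℕ) : ℝ) * π / 4 : ℝ) : ℂ) * Complex.I) = 0 := by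
  have h : ∀ k : Fin 8, Complex.exp (((((k : ℕ) : ℝ) * π / 4 : ℝ) : ℂ) * Complex.I)
      = Complex.exp (π / 4 * Complex.I) ^ (k : ℕ) := by
    intro k
    rw [← Complex.exp_nat_mul]
    congr 1
    push_cast
    ring
  have h4 : Complex.exp (π / 4 * Complex.I) ^ 4 = -1 := by
    rw [← Complex.exp_nat_mul, ← Complex.exp_pi_mul_I]
    congr 1
    push_cast
    ring
  simp only [h]
  generalize Complex.exp (π / 4 * Complex.I) = w at h4
  simp only [Fin.sum_univ_eight]
  norm_num
  linear_combination (1 + w + w ^ 2 + w ^ 3) * h4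

lemma sum_rzDiag (i j : Fin 2) :
    ∑ k : Fin 8, rzDiag (((k : ℕ) : ℝ) * π / 4) i * star (rzDiag (((k : ℕ) : ℝ) * π / 4) j)
      = if i = j then 8 else 0 := by
  have hs := sum_exp_eighth
  have hc := congrArg star hs
  rw [star_sum, star_zero] at hc
  fin_cases i <;> fin_cases j
  · simp [rzDiag]
  · simpa only [rzDiag, Fin.zero_eta, Fin.mk_one, Matrix.cons_val_zero, Matrix.cons_val_one,
      one_mul, zero_ne_one, if_false] using hc
  · simpa only [rzDiag, Fin.zero_eta, Fin.mk_one, Matrix.cons_val_zero, Matrix.cons_val_one,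
      star_one, mul_one, one_ne_zero, if_false] using hs
  · have h1 : ∀ θ : ℝ, Complex.exp (θ * Complex.I) * star (Complex.exp (θ * Complex.I)) = 1 := by
      intro θ
      rw [Complex.star_def, Complex.mul_conj, Complex.normSq_eq_norm_sq,
        Complex.norm_exp_ofReal_mul_I]
      simp
    simp only [rzDiag, Fin.mk_one, Matrix.cons_val_one, Matrix.cons_val_zero, h1]
    simp

/-- Blindness of the full two-qubit initial state: independently averaging z-rotations
from `𝒜 = {jπ/4}` on the two qubits removes every off-diagonal entry of `ρ`. -/
theorem two_qubit_twirl (ρ : Matrix (Fin 2 × Fin 2) (Fin 2 × Fin 2) ℂ) :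
    (64 : ℂ)⁻¹ • ∑ k : Fin 8, ∑ l : Fin 8,
        (Rz (((k : ℕ) : ℝ) * π / 4) ⊗ₖ Rz (((l : ℕ) : ℝ) * π / 4)) * ρ *
          (Rz (((k : ℕ) : ℝ) * π / 4) ⊗ₖ Rz (((l : ℕ) : ℝ) * π / 4))ᴴ =
      Matrix.diagonal (fun i => ρ i i) := by
  ext ⟨a, b⟩ ⟨c, d⟩
  have key : ∑ k : Fin 8, ∑ l : Fin 8,
      (rzDiag (((k : ℕ) : ℝ) * π / 4) a * rzDiag (((l : ℕ) : ℝ) * π / 4) b) * ρ (a, b) (c, d) *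
        star (rzDiag (((k : ℕ) : ℝ) * π / 4) c * rzDiag (((l : ℕ) : ℝ) * π / 4) d)
      = (if a = c then 8 else 0) * (if b = d then 8 else 0) * ρ (a, b) (c, d) := by
    rw [← sum_rzDiag a c, ← sum_rzDiag b d, Finset.sum_mul_sum, Finset.sum_mul]
    refine Finset.sum_congr rfl fun k _ => ?_
    rw [Finset.sum_mul]
    refine Finset.sum_congr rfl fun l _ => ?_
    rw [star_mul']
    ring
  simp only [Rz_eq_diagonal, Matrix.diagonal_kronecker_diagonal, Matrix.diagonal_conjTranspose,
    Matrix.smul_apply, Matrix.sum_apply, Matrix.mul_diagonal, Matrix.diagonal_mul, Pi.star_apply,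
    smul_eq_mul]
  rw [key, Matrix.diagonal_apply]
  by_cases h1 : a = c
  · by_cases h2 : b = d
    · subst h1 h2
      simp only [if_true]
      ring
    · simp [h2]
  · simp [h1]
end

section
/- Correctness of the phase-shift table with outcome flip: let δ₂ be a real angle, f ∈ {0,1}, and φ a real number such that φ + fπ ≡ −δ₂ (mod 2π). Then (−1)^f · (U_PC(φ)† · H · Z · H · U_PC(φ)) = cos δ₂ · X + sin δ₂ · Y = |+_{δ₂}⟩⟨+_{δ₂}| − |−_{δ₂}⟩⟨−_{δ₂}|; i.e., applying the Pockels-cell phase φ, measuring after a half-wave plate at π/8 and a polarizing beam splitter, and flipping the outcome when f = 1, implements the projective measurement in the basis {|+_{δ₂}⟩, |−_{δ₂}⟩}. In particular, for each δ₂ = kπ/4 with k ∈ {0,…,7} only the four phase shifts φ ∈ {0, π/4, π/2, 3π/4} are needed. -/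
open Real Matrix

/-- The Pockels-cell phase-shift matrix `U_PC(φ) = !![1, 0; 0, e^{iφ}]`. -/
noncomputable def UPC (φ : ℝ) : Matrix (Fin 2) (Fin 2) ℂ :=
  !![1, 0; 0, Complex.exp (φ * Complex.I)]

/-- The Hadamard gate `H = (1/√2)·!![1, 1; 1, −1]`. -/
noncomputable def Hgate : Matrix (Fin 2) (Fin 2) ℂ :=
  (Real.sqrt 2 : ℂ)⁻¹ • !![1, 1; 1, -1]

/-- The Pauli `X` matrix. -/
def Xgate : Matrix (Fin 2) (Fin 2) ℂ := !![0, 1; 1, 0]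

/-- The Pauli `Y` matrix. -/
def Ygate : Matrix (Fin 2) (Fin 2) ℂ := !![0, -Complex.I; Complex.I, 0]

/-- The Pauli `Z` matrix. -/
def Zgate : Matrix (Fin 2) (Fin 2) ℂ := !![1, 0; 0, -1]

/-- The rotated plus state `|+_δ⟩ = (1/√2)(e₀ + e^{iδ} e₁)` in `ℂ²`. -/
noncomputable def plusKet (δ : ℝ) : Fin 2 → ℂ :=
  ![(Real.sqrt 2 : ℂ)⁻¹, Complex.exp (δ * Complex.I) * (Real.sqrt 2 : ℂ)⁻¹]

/-- The rotated minus state `|−_δ⟩ = (1/√2)(e₀ − e^{iδ} e₁)` in `ℂ²`. -/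
noncomputable def minusKet (δ : ℝ) : Fin 2 → ℂ :=
  ![(Real.sqrt 2 : ℂ)⁻¹, -(Complex.exp (δ * Complex.I) * (Real.sqrt 2 : ℂ)⁻¹)]

/-- The outer product `|u⟩⟨u|` as a 2×2 matrix. -/
noncomputable def outerProj (u : Fin 2 → ℂ) : Matrix (Fin 2) (Fin 2) ℂ :=
  Matrix.vecMulVec u (star u)

lemma expI_conj (x : ℝ) : (starRingEnd ℂ) (Complex.exp (x * Complex.I)) =
    Real.cos x - Real.sin x * Complex.I := by
  rw [← Complex.exp_conj]
  simp only [map_mul, Complex.conj_ofReal, Complex.conj_I]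
  rw [mul_neg, ← neg_mul, Complex.exp_mul_I, Complex.cos_neg, Complex.sin_neg]
  push_cast; ring

lemma expI (x : ℝ) : Complex.exp (x * Complex.I) =
    Real.cos x + Real.sin x * Complex.I := by
  rw [Complex.exp_mul_I]; push_cast; ring

lemma sqrt_two_inv_sq : ((Real.sqrt 2 : ℂ)⁻¹) * ((Real.sqrt 2 : ℂ)⁻¹) = 1 / 2 := by
  rw [← mul_inv, ← Complex.ofReal_mul, Real.mul_self_sqrt (by norm_num)]
  norm_num

lemma HZH : Hgate * Zgate * Hgate = Xgate := by
  have h := sqrt_two_inv_sq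
  unfold Hgate Zgate Xgate
  generalize (Real.sqrt 2 : ℂ)⁻¹ = s at *
  ext i j
  fin_cases i <;> fin_cases j <;> simp [Matrix.mul_apply, Fin.sum_univ_two] <;>
    linear_combination 2 * h

lemma conj_X (φ : ℝ) : (UPC φ)ᴴ * Hgate * Zgate * Hgate * UPC φ =
    (Real.cos φ : ℂ) • Xgate - (Real.sin φ : ℂ) • Ygate := by
  have : (UPC φ)ᴴ * Hgate * Zgate * Hgate * UPC φ =
      (UPC φ)ᴴ * (Hgate * Zgate * Hgate) * UPC φ := by simp only [Matrix.mul_assoc]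
  rw [this, HZH]
  have h1 := expI_conj φ
  have h2 := expI φ
  unfold UPC Xgate Ygate
  generalize Complex.exp (φ * Complex.I) = e at *
  ext i j
  fin_cases i <;> fin_cases j <;>
    simp [Matrix.mul_apply, Fin.sum_univ_two, -Complex.ofReal_cos, -Complex.ofReal_sin, h1, h2]
  ring

/-- Correctness of the phase-shift table with outcome flip: if `φ + fπ ≡ −δ₂ (mod 2π)`,
then `(−1)^f · (U_PC(φ)† · H · Z · H · U_PC(φ)) = cos δ₂ · X + sin δ₂ · Y
= |+_{δ₂}⟩⟨+_{δ₂}| − |−_{δ₂}⟩⟨−_{δ₂}|`; moreover for each `δ₂ = kπ/4` only the four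
phase shifts `φ ∈ {0, π/4, π/2, 3π/4}` are needed. -/
theorem phase_shift_table_correct (δ₂ : ℝ) (f : Fin 2) (φ : ℝ)
    (hφ : ∃ k : ℤ, φ + ((f : ℕ) : ℝ) * π = -δ₂ + 2 * π * k) :
    ((-1 : ℂ) ^ (f : ℕ) • ((UPC φ)ᴴ * Hgate * Zgate * Hgate * UPC φ) =
        (Real.cos δ₂ : ℂ) • Xgate + (Real.sin δ₂ : ℂ) • Ygate ∧
      (Real.cos δ₂ : ℂ) • Xgate + (Real.sin δ₂ : ℂ) • Ygate =
        outerProj (plusKet δ₂) - outerProj (minusKet δ₂)) ∧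
    ∀ k : Fin 8, ∃ (f' : Fin 2) (φ' : ℝ),
      φ' ∈ ({0, π / 4, π / 2, 3 * π / 4} : Set ℝ) ∧
      ∃ j : ℤ, φ' + ((f' : ℕ) : ℝ) * π = -(((k : ℕ) : ℝ) * π / 4) + 2 * π * j := by
  refine ⟨⟨?_, ?_⟩, ?_⟩
  · obtain ⟨k, hk⟩ := hφ
    rw [conj_X]
    have hc : Real.cos (φ + ((f : ℕ) : ℝ) * π) = Real.cos δ₂ := by
      rw [hk, show -δ₂ + 2 * π * k = -δ₂ + k * (2 * π) by ring, Real.cos_add_int_mul_two_pi,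
        Real.cos_neg]
    have hs : Real.sin (φ + ((f : ℕ) : ℝ) * π) = -Real.sin δ₂ := by
      rw [hk, show -δ₂ + 2 * π * k = -δ₂ + k * (2 * π) by ring, Real.sin_add_int_mul_two_pi,
        Real.sin_neg]
    have hs' : Real.sin δ₂ = -Real.sin (φ + ((f : ℕ) : ℝ) * π) := by rw [hs, neg_neg]
    rw [← hc, hs']
    clear hc hs hs' hk
    rw [Real.cos_add_nat_mul_pi, Real.sin_add_nat_mul_pi]
    push_cast
    module
  · have h := sqrt_two_inv_sq
    have hr : (starRingEnd ℂ) ((Real.sqrt 2 : ℂ)⁻¹) = (Real.sqrt 2 : ℂ)⁻¹ := by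
      rw [map_inv₀, Complex.conj_ofReal]
    have h1 := expI_conj δ₂
    have h2 := expI δ₂
    have h3 : Complex.exp (δ₂ * Complex.I) * (starRingEnd ℂ) (Complex.exp (δ₂ * Complex.I)) = 1 := by
      rw [Complex.mul_conj, Complex.normSq_eq_norm_sq, Complex.norm_exp_ofReal_mul_I]; simp
    unfold outerProj plusKet minusKet Xgate Ygate
    generalize (Real.sqrt 2 : ℂ)⁻¹ = s at *
    ext i j
    rw [Matrix.sub_apply, Matrix.vecMulVec_apply, Matrix.vecMulVec_apply]
    fin_cases i <;> fin_cases j <;>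
      simp [ -Complex.ofReal_cos, -Complex.ofReal_sin, hr, h1, h2]
    · linear_combination (-2 * (Real.cos δ₂ - Real.sin δ₂ * Complex.I)) * h
    · linear_combination (-2 * (Real.cos δ₂ + Real.sin δ₂ * Complex.I)) * h
  · intro k
    fin_cases k
    · exact ⟨0, 0, by simp, 0, by simp⟩
    · exact ⟨1, 3 * π / 4, by simp, 1, by simp; ring⟩
    · exact ⟨1, π / 2, by simp, 1, by simp; ring⟩
    · exact ⟨1, π / 4, by simp, 1, by simp; ring⟩
    · exact ⟨1, 0, by simp, 1, by simp; ring⟩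
    · exact ⟨0, 3 * π / 4, by simp, 1, by simp; ring⟩
    · exact ⟨0, π / 2, by simp, 1, by simp; ring⟩
    · exact ⟨0, π / 4, by simp, 1, by simp; ring⟩
end
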